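/- arXiv:0904.2432 — 4 statements merged into one kernel-verified Lean document; each statement's English description precedes it below -/
import Mathlib

section
/- For all 1 ≤ k, p, q ≤ r and all a, b ∈ 𝔞, the commutator satisfies [Evert_k(a), EBL_{p,q}(b)] = δ_{k,p}·Ehort_q(−ā·b) + δ_{k,q}·Ehort_p(ā·b̄). -/
namespace GIMPaper

/-- The paper's `E_{i,j}(a)`: the `(2r+1) × (2r+1)` matrix over `A` whose entry at the
(1-based) position `(i, j)` is `a` and all of whose other entries are `0`. -/
def E (A : Type*) [Ring A] (r i j : ℕ) (a : A) :
    Matrix (Fin (2 * r + 1)) (Fin (2 * r + 1)) A :=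
  fun x y => if (x : ℕ) + 1 = i ∧ (y : ℕ) + 1 = j then a else 0

/-- `Evert_k(a) = E_{k,r+1}(a) + E_{r+1,2r+2-k}(-η a)`. -/
def Evert (A : Type*) [Ring A] (r : ℕ) (η : A → A) (k : ℕ) (a : A) :
    Matrix (Fin (2 * r + 1)) (Fin (2 * r + 1)) A :=
  E A r k (r + 1) a + E A r (r + 1) (2 * r + 2 - k) (-η a)

/-- `Ehort_k(a) = E_{r+1,k}(a) + E_{2r+2-k,r+1}(-η a)`. -/
def Ehort (A : Type*) [Ring A] (r : ℕ) (η : A → A) (k : ℕ) (a : A) :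
    Matrix (Fin (2 * r + 1)) (Fin (2 * r + 1)) A :=
  E A r (r + 1) k a + E A r (2 * r + 2 - k) (r + 1) (-η a)

/-- `EUL_{p,q}(a) = E_{p,q}(a) + E_{2r+2-q,2r+2-p}(-η a)`. -/
def EUL (A : Type*) [Ring A] (r : ℕ) (η : A → A) (p q : ℕ) (a : A) :
    Matrix (Fin (2 * r + 1)) (Fin (2 * r + 1)) A :=
  E A r p q a + E A r (2 * r + 2 - q) (2 * r + 2 - p) (-η a)

/-- `EUR_{p,q}(a) = E_{p,2r+2-q}(a) + E_{q,2r+2-p}(-η a)`. -/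
def EUR (A : Type*) [Ring A] (r : ℕ) (η : A → A) (p q : ℕ) (a : A) :
    Matrix (Fin (2 * r + 1)) (Fin (2 * r + 1)) A :=
  E A r p (2 * r + 2 - q) a + E A r q (2 * r + 2 - p) (-η a)

/-- `EBL_{p,q}(a) = E_{2r+2-p,q}(a) + E_{2r+2-q,p}(-η a)`. -/
def EBL (A : Type*) [Ring A] (r : ℕ) (η : A → A) (p q : ℕ) (a : A) :
    Matrix (Fin (2 * r + 1)) (Fin (2 * r + 1)) A :=
  E A r (2 * r + 2 - p) q a + E A r (2 * r + 2 - q) p (-η a)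

end GIMPaper

open GIMPaper

theorem E_mul_E (A : Type*) [Ring A] (r i j k l : ℕ) (hj : 1 ≤ j) (hj' : j ≤ 2 * r + 1)
    (a b : A) : E A r i j a * E A r k l b = if j = k then E A r i l (a * b) else 0 := by
  ext x y
  rw [Matrix.mul_apply, Finset.sum_eq_single (⟨j - 1, by omega⟩ : Fin (2 * r + 1))]
  · have h : j - 1 + 1 = j := by omega
    simp only [E, h]
    by_cases h1 : (x : ℕ) + 1 = i <;> by_cases h2 : j = k <;>
      by_cases h3 : (y : ℕ) + 1 = l <;> simp [E, h1, h2, h3]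
  · intro z _ hz
    have : ¬ ((z : ℕ) + 1 = j) := fun h => hz (Fin.ext (by simp; omega))
    simp [E, this]
  · simp

theorem E_neg (A : Type*) [Ring A] (r i j : ℕ) (a : A) : E A r i j (-a) = - E A r i j a := by
  ext x y
  simp only [E, Matrix.neg_apply]
  split_ifs <;> simp

theorem stmt_3
    (r : ℕ) (hr : 3 ≤ r) (A : Type*) [Ring A] [Algebra ℂ A]
    (η : A → A)
    (hη_add : ∀ a b : A, η (a + b) = η a + η b)
    (hη_smul : ∀ (c : ℂ) (a : A), η (c • a) = c • η a)
    (hη_mul : ∀ a b : A, η (a * b) = η b * η a)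
    (hη_one : η (1 : A) = 1)
    (hη_invol : ∀ a : A, η (η a) = a)
    (k p q : ℕ) (hk1 : 1 ≤ k) (hkr : k ≤ r) (hp1 : 1 ≤ p) (hpr : p ≤ r)
    (hq1 : 1 ≤ q) (hqr : q ≤ r) (a b : A) :
    Evert A r η k a * EBL A r η p q b - EBL A r η p q b * Evert A r η k a
      = (if k = p then Ehort A r η q (-(η a * b)) else 0)
        + (if k = q then Ehort A r η p (η a * η b) else 0) := by
  have hneg : ∀ x : A, η (-x) = - η x := fun x => by
    have := hη_smul (-1) x
    simpa using this
  have e1 : ¬ (r + 1 = 2 * r + 2 - p) := by omega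
  have e2 : ¬ (r + 1 = 2 * r + 2 - q) := by omega
  have e3 : ¬ (q = r + 1) := by omega
  have e4 : ¬ (p = r + 1) := by omega
  have e5 : (2 * r + 2 - k = 2 * r + 2 - p) = (k = p) := propext (by omega)
  have e6 : (2 * r + 2 - k = 2 * r + 2 - q) = (k = q) := propext (by omega)
  simp only [Evert, EBL, Ehort, add_mul, mul_add]
  repeat rw [E_mul_E _ _ _ _ _ _ (by omega) (by omega)]
  simp only [e1, e2, e3, e4, e5, e6, if_false, eq_comm (a := q) (b := k),
    eq_comm (a := p) (b := k), hneg, hη_mul, hη_invol, neg_mul, mul_neg, neg_neg, E_neg]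
  split_ifs <;> abel
end

section
/- For all 1 ≤ p, q, k, l ≤ r with p ≠ q and k ≠ l, and all u, v ∈ 𝔞, the third iterated adjoint action vanishes: (ad EUL_{p,q}(u))³ (EUL_{k,l}(v)) = [EUL_{p,q}(u), [EUL_{p,q}(u), [EUL_{p,q}(u), EUL_{k,l}(v)]]] = 0. -/
open GIMPaper

lemma lie_cube_zero {R : Type*} [Ring R] (x y : R) (h : x * x = 0) :
    ⁅x, ⁅x, ⁅x, y⁆⁆⁆ = 0 := by
  have h2 : ∀ z : R, x * (x * z) = 0 := fun z => by rw [← mul_assoc, h, zero_mul]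
  simp [Ring.lie_def, mul_sub, sub_mul, mul_assoc, h, h2]

theorem stmt_12
    (r : ℕ) (hr : 3 ≤ r) (A : Type*) [Ring A] [Algebra ℂ A]
    (η : A → A)
    (hη_add : ∀ a b : A, η (a + b) = η a + η b)
    (hη_smul : ∀ (c : ℂ) (a : A), η (c • a) = c • η a)
    (hη_mul : ∀ a b : A, η (a * b) = η b * η a)
    (hη_one : η (1 : A) = 1)
    (hη_invol : ∀ a : A, η (η a) = a)
    (p q k l : ℕ) (hp1 : 1 ≤ p) (hpr : p ≤ r) (hq1 : 1 ≤ q) (hqr : q ≤ r)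
    (hk1 : 1 ≤ k) (hkr : k ≤ r) (hl1 : 1 ≤ l) (hlr : l ≤ r)
    (hpq : p ≠ q) (hkl : k ≠ l) (u v : A) :
    ⁅EUL A r η p q u, ⁅EUL A r η p q u, ⁅EUL A r η p q u, EUL A r η k l v⁆⁆⁆ = 0 := by
  apply lie_cube_zero
  ext x y
  rw [Matrix.mul_apply]
  apply Finset.sum_eq_zero
  intro z _
  simp only [EUL, E, Matrix.add_apply]
  split_ifs <;> first | omega | simp
end

section
/- Let 1 ≤ p < q ≤ r and a, a′ ∈ 𝔞, and set h := [EUL_{p,q}(a), EUL_{q,p}(a′)]. Suppose that [h, X_q] = −X_q and [h, X_p] = (1 + δ_{q,p+1})·X_p, where X_j := EUL_{j,j+1}(1) for 1 ≤ j ≤ r−1 and X_r := Evert_r(√2·1) (with √2·1 the image of √2 ∈ ℂ in 𝔞). Then a′·a = 1 and a·a′ = 1; in particular a is invertible in 𝔞 with inverse a′. -/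
open GIMPaper

/-- `X_j := EUL_{j,j+1}(1)` for `j ≠ r` and `X_r := Evert_r(√2 · 1)`, where `√2 · 1` is the
image of `√2 ∈ ℂ` in `A`. -/
noncomputable def Xgen (A : Type*) [Ring A] [Algebra ℂ A] (r : ℕ) (η : A → A) (j : ℕ) :
    Matrix (Fin (2 * r + 1)) (Fin (2 * r + 1)) A :=
  if j = r then Evert A r η r (algebraMap ℂ A ((Real.sqrt 2 : ℝ) : ℂ))
  else EUL A r η j (j + 1) (1 : A)

theorem GIMPaper.E_mul_same (A : Type*) [Ring A] (r i j l : ℕ) (hj : 1 ≤ j) (hj' : j ≤ 2 * r + 1)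
    (a b : A) : E A r i j a * E A r j l b = E A r i l (a * b) := by
  ext x y
  rw [Matrix.mul_apply, Finset.sum_eq_single (⟨j - 1, by omega⟩ : Fin (2 * r + 1))]
  · have : j - 1 + 1 = j := by omega
    simp only [E, this]
    by_cases h1 : (x : ℕ) + 1 = i <;> by_cases h2 : (y : ℕ) + 1 = l <;> simp [h1, h2]
  · intro z _ hz
    have : (z : ℕ) + 1 ≠ j := by
      intro hc
      apply hz
      ext
      simp only
      omega
    simp [E, this]
  · simp

theorem GIMPaper.E_mul_ne (A : Type*) [Ring A] (r i j k l : ℕ) (hjk : j ≠ k)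
    (a b : A) : E A r i j a * E A r k l b = 0 := by
  ext x y
  rw [Matrix.mul_apply, Matrix.zero_apply]
  apply Finset.sum_eq_zero
  intro z _
  by_cases h1 : (z : ℕ) + 1 = j
  · have : (z : ℕ) + 1 ≠ k := by omega
    simp [E, this]
  · simp [E, h1]

theorem GIMPaper.E_diag (A : Type*) [Ring A] (r i : ℕ) (a : A) :
    E A r i i a = Matrix.diagonal (fun x : Fin (2 * r + 1) => if (x : ℕ) + 1 = i then a else 0) := by
  ext x y
  by_cases hxy : x = y
  · subst hxy
    simp [E]
  · have : ¬ ((x : ℕ) + 1 = i ∧ (y : ℕ) + 1 = i) := by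
      intro hc
      apply hxy
      ext
      omega
    simp [E, hxy, this]

theorem stmt_14
    (r : ℕ) (hr : 3 ≤ r) (A : Type*) [Ring A] [Algebra ℂ A]
    (η : A → A)
    (hη_add : ∀ a b : A, η (a + b) = η a + η b)
    (hη_smul : ∀ (c : ℂ) (a : A), η (c • a) = c • η a)
    (hη_mul : ∀ a b : A, η (a * b) = η b * η a)
    (hη_one : η (1 : A) = 1)
    (hη_invol : ∀ a : A, η (η a) = a)
    (p q : ℕ) (hp1 : 1 ≤ p) (hpq : p < q) (hqr : q ≤ r) (a a' : A)
    (h : Matrix (Fin (2 * r + 1)) (Fin (2 * r + 1)) A)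
    (hh : h = EUL A r η p q a * EUL A r η q p a' - EUL A r η q p a' * EUL A r η p q a)
    (hXq : h * Xgen A r η q - Xgen A r η q * h = -Xgen A r η q)
    (hXp : h * Xgen A r η p - Xgen A r η p * h
        = ((1 : ℤ) + (if q = p + 1 then 1 else 0)) • Xgen A r η p) :
    a' * a = 1 ∧ a * a' = 1 := by
  have hd : h = Matrix.diagonal (fun x : Fin (2 * r + 1) =>
      (if (x : ℕ) + 1 = p then a * a' else 0)
      + (if (x : ℕ) + 1 = 2 * r + 2 - q then -η a * -η a' else 0)
      - ((if (x : ℕ) + 1 = q then a' * a else 0)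
      + (if (x : ℕ) + 1 = 2 * r + 2 - p then -η a' * -η a else 0))) := by
    rw [hh]
    unfold EUL
    rw [add_mul, mul_add, mul_add, add_mul, mul_add, mul_add,
      E_mul_same A r p q p (by omega) (by omega), E_mul_ne A r p q _ _ (by omega),
      E_mul_ne A r _ _ q p (by omega),
      E_mul_same A r (2 * r + 2 - q) (2 * r + 2 - p) (2 * r + 2 - q) (by omega) (by omega),
      E_mul_same A r q p q (by omega) (by omega), E_mul_ne A r q p _ _ (by omega),
      E_mul_ne A r _ _ p q (by omega),
      E_mul_same A r (2 * r + 2 - p) (2 * r + 2 - q) (2 * r + 2 - p) (by omega) (by omega)]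
    simp only [E_diag, add_zero, zero_add, Matrix.diagonal_add, Matrix.diagonal_sub]
  have key1 : a' * a = 1 := by
    have e := congrFun (congrFun hXq ⟨q - 1, by omega⟩) ⟨q, by omega⟩
    rw [hd, Matrix.sub_apply, Matrix.diagonal_mul, Matrix.mul_diagonal, Matrix.neg_apply] at e
    have t1 : q - 1 + 1 = q := by omega
    have t2 : q ≠ p := by omega
    have t3 : q ≠ 2 * r + 2 - q := by omega
    have t4 : q ≠ 2 * r + 2 - p := by omega
    have t5 : q + 1 ≠ p := by omega
    have t6 : q + 1 ≠ 2 * r + 2 - q := by omega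
    have t7 : q + 1 ≠ 2 * r + 2 - p := by omega
    simp only [t1, t2, t3, t4, t5, t6, t7, if_true, if_false, Nat.succ_ne_self, add_zero, zero_add,
      sub_zero, mul_zero, zero_sub, neg_mul, neg_inj] at e
    by_cases hq : q = r
    · subst hq
      have hx : Xgen A q η q ⟨q - 1, by omega⟩ ⟨q, by omega⟩
          = algebraMap ℂ A ((Real.sqrt 2 : ℝ) : ℂ) := by
        have : ¬ q = q + 1 := by omega
        simp [Xgen, Evert, E, t1, this]
      rw [hx] at e
      have hs : ((Real.sqrt 2 : ℝ) : ℂ) ≠ 0 := by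
        simp
      have hu : algebraMap ℂ A ((Real.sqrt 2 : ℝ) : ℂ)
          * algebraMap ℂ A (((Real.sqrt 2 : ℝ) : ℂ)⁻¹) = 1 := by
        rw [← map_mul, mul_inv_cancel₀ hs, map_one]
      have e2 := congrArg (· * algebraMap ℂ A (((Real.sqrt 2 : ℝ) : ℂ)⁻¹)) e
      simpa only [mul_assoc, hu, mul_one] using e2
    · have hx : Xgen A r η q ⟨q - 1, by omega⟩ ⟨q, by omega⟩ = 1 := by
        have : q ≠ 2 * r + 2 - (q + 1) := by omega
        simp [Xgen, EUL, E, t1, hq]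
        omega
      rw [hx] at e
      simpa using e
  refine ⟨key1, ?_⟩
  have e := congrFun (congrFun hXp ⟨p - 1, by omega⟩) ⟨p, by omega⟩
  rw [hd, Matrix.sub_apply, Matrix.diagonal_mul, Matrix.mul_diagonal, Matrix.smul_apply] at e
  have t1 : p - 1 + 1 = p := by omega
  have t2 : p ≠ q := by omega
  have t3 : p ≠ 2 * r + 2 - q := by omega
  have t4 : p ≠ 2 * r + 2 - p := by omega
  have t6 : p + 1 ≠ 2 * r + 2 - q := by omega
  have t7 : p + 1 ≠ 2 * r + 2 - p := by omega
  have hx : Xgen A r η p ⟨p - 1, by omega⟩ ⟨p, by omega⟩ = 1 := by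
    have h1 : p ≠ 2 * r + 2 - (p + 1) := by omega
    have h2 : p ≠ r := by omega
    simp [Xgen, EUL, E, t1, h2]
    omega
  rw [hx] at e
  simp only [t1, t2, t3, t4, t6, t7, if_true, if_false, Nat.succ_ne_self, add_zero, zero_add,
      sub_zero, mul_one, one_mul, zero_sub, key1] at e
  by_cases hc : q = p + 1
  · simp only [hc, if_true, sub_neg_eq_add, add_smul, one_smul] at e
    exact add_right_cancel e
  · have hc' : p + 1 ≠ q := fun h => hc h.symm
    simpa [hc, hc'] using e
end

section
/- Let 1 ≤ p ≤ r−1. (a) If a ∈ 𝔞 satisfies [EUR_{p,p+1}(a), EUL_{p,p+1}(1)] = 0, then η(a) = a. (b) If b ∈ 𝔞 satisfies [EUL_{p,p+1}(1), EBL_{p,p+1}(b)] = 0, then η(b) = b. -/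
open GIMPaper

theorem E_mul_E_same (A : Type*) [Ring A] (r i j l : ℕ) (a b : A) (h1 : 1 ≤ j)
    (h2 : j ≤ 2 * r + 1) : E A r i j a * E A r j l b = E A r i l (a * b) := by
  ext x y
  rw [Matrix.mul_apply, Finset.sum_eq_single (⟨j - 1, by omega⟩ : Fin (2 * r + 1))]
  · have hj : j - 1 + 1 = j := by omega
    by_cases hx : (x : ℕ) + 1 = i <;> by_cases hy : (y : ℕ) + 1 = l <;> simp [E, hj, hx, hy]
  · intro k _ hk
    have : ¬ ((k : ℕ) + 1 = j) := by
      intro h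
      exact hk (Fin.ext (by simp; omega))
    simp [E, this]
  · simp

theorem E_mul_E_ne (A : Type*) [Ring A] (r i j k l : ℕ) (a b : A) (h : j ≠ k) :
    E A r i j a * E A r k l b = 0 := by
  ext x y
  rw [Matrix.mul_apply]
  refine Finset.sum_eq_zero fun m _ => ?_
  by_cases hm : (m : ℕ) + 1 = j
  · have : ¬ ((m : ℕ) + 1 = k) := by omega
    simp [E, this]
  · simp [E, hm]

theorem E_sub_eq_zero (A : Type*) [Ring A] (r i j : ℕ) (a b : A)
    (hi : 1 ≤ i) (hi' : i ≤ 2 * r + 1) (hj : 1 ≤ j) (hj' : j ≤ 2 * r + 1)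
    (h : E A r i j a - E A r i j b = 0) : a = b := by
  have := congrFun (congrFun h ⟨i - 1, by omega⟩) ⟨j - 1, by omega⟩
  have e1 : i - 1 + 1 = i := by omega
  have e2 : j - 1 + 1 = j := by omega
  simpa [E, e1, e2, sub_eq_zero] using this

theorem stmt_17
    (r : ℕ) (hr : 3 ≤ r) (A : Type*) [Ring A] [Algebra ℂ A]
    (η : A → A)
    (hη_add : ∀ a b : A, η (a + b) = η a + η b)
    (hη_smul : ∀ (c : ℂ) (a : A), η (c • a) = c • η a)
    (hη_mul : ∀ a b : A, η (a * b) = η b * η a)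
    (hη_one : η (1 : A) = 1)
    (hη_invol : ∀ a : A, η (η a) = a)
    (p : ℕ) (hp1 : 1 ≤ p) (hpr : p ≤ r - 1) :
    (∀ a : A,
        EUR A r η p (p + 1) a * EUL A r η p (p + 1) 1
            - EUL A r η p (p + 1) 1 * EUR A r η p (p + 1) a = 0
          → η a = a)
    ∧ (∀ b : A,
        EUL A r η p (p + 1) 1 * EBL A r η p (p + 1) b
            - EBL A r η p (p + 1) b * EUL A r η p (p + 1) 1 = 0
          → η b = b) := by
  constructor
  · intro a h
    simp only [EUR, EUL, add_mul, mul_add, hη_one] at h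
    rw [E_mul_E_same _ _ _ (2 * r + 2 - (p + 1)) _ _ _ (by omega) (by omega),
      E_mul_E_same _ _ _ (p + 1) _ _ _ (by omega) (by omega)] at h
    repeat rw [E_mul_E_ne _ _ _ _ _ _ _ _ (by omega)] at h
    simp only [add_zero, zero_add, mul_one, one_mul, mul_neg] at h
    have := E_sub_eq_zero _ _ _ _ _ _ (by omega) (by omega) (by omega) (by omega) h
    exact (neg_injective this).symm
  · intro b h
    simp only [EBL, EUL, add_mul, mul_add, hη_one] at h
    rw [E_mul_E_same _ _ _ (2 * r + 2 - p) _ _ _ (by omega) (by omega),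
      E_mul_E_same _ _ _ p _ _ _ (by omega) (by omega)] at h
    repeat rw [E_mul_E_ne _ _ _ _ _ _ _ _ (by omega)] at h
    simp only [add_zero, zero_add, mul_one, one_mul, neg_mul] at h
    have := E_sub_eq_zero _ _ _ _ _ _ (by omega) (by omega) (by omega) (by omega) h
    exact (neg_injective this).symm
end
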